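/- arXiv:math/0610082 — 4 statements merged into one kernel-verified Lean document; each statement's English description precedes it below -/
import Mathlib

section
/- The correspondence M ↦ A_M from 𝒢 to fractal-linear transformations is injective: if M, N ∈ 𝒢 and U ⊆ ℝ³ is a nonempty open set such that for every (y¹,y²,t) ∈ U both denominators (M·v)₁ and (N·v)₁ are nonzero (where v = (t,1,y¹,y²)) and A_M(y¹,y²,t) = A_N(y¹,y²,t), then M = N. -/
/-- The homogeneous vector `v = (t, 1, y¹, y²)` associated to `(y¹, y², t) ∈ ℝ³`. -/
def homVec (y1 y2 t : ℝ) : Fin 4 → ℝ := ![t, 1, y1, y2]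

/-- The denominator `(M·v)₁` of the fractal-linear transformation `A_M` at `(y¹,y²,t)`. -/
def fracDen (M : Matrix (Fin 4) (Fin 4) ℝ) (y1 y2 t : ℝ) : ℝ :=
  M.mulVec (homVec y1 y2 t) 1

/-- The fractal-linear transformation `A_M (y¹,y²,t) = (w₂/w₁, w₃/w₁, w₀/w₁)`
where `w = M·v`, `v = (t,1,y¹,y²)`. -/
noncomputable def fracLin (M : Matrix (Fin 4) (Fin 4) ℝ) (y1 y2 t : ℝ) : ℝ × ℝ × ℝ :=
  (M.mulVec (homVec y1 y2 t) 2 / M.mulVec (homVec y1 y2 t) 1,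
   M.mulVec (homVec y1 y2 t) 3 / M.mulVec (homVec y1 y2 t) 1,
   M.mulVec (homVec y1 y2 t) 0 / M.mulVec (homVec y1 y2 t) 1)

/-- If `A_M` and `A_N` agree at two points that differ only in `t`, then the homogeneous images
of these points agree. -/
theorem mulVec_homVec_eq_of_fracLin_eq {M N : Matrix (Fin 4) (Fin 4) ℝ}
    (hM : M 0 0 = 1 ∧ M 1 0 = 0 ∧ M 2 0 = 0 ∧ M 3 0 = 0)
    (hN : N 0 0 = 1 ∧ N 1 0 = 0 ∧ N 2 0 = 0 ∧ N 3 0 = 0)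
    {a b t s : ℝ} (hts : t ≠ s) (hMd : fracDen M a b t ≠ 0) (hNd : fracDen N a b t ≠ 0)
    (ht : fracLin M a b t = fracLin N a b t) (hs : fracLin M a b s = fracLin N a b s) :
    M.mulVec (homVec a b t) = N.mulVec (homVec a b t) := by
  obtain ⟨hM0, hM1, hM2, hM3⟩ := hM
  obtain ⟨hN0, hN1, hN2, hN3⟩ := hN
  simp only [fracDen, fracLin, homVec, Matrix.mulVec, dotProduct, Fin.sum_univ_four,
    Matrix.cons_val, hM0, hM1, hM2, hM3, hN0, hN1, hN2, hN3, zero_mul, zero_add, one_mul, mul_one,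
    Prod.mk.injEq] at hMd hNd ht hs
  obtain ⟨ht2, ht3, ht0⟩ := ht
  have hs0 := hs.2.2
  rw [div_eq_div_iff hMd hNd] at ht2 ht3 ht0 hs0
  have hd : M 1 1 + M 1 2 * a + M 1 3 * b = N 1 1 + N 1 2 * a + N 1 3 * b :=
    mul_left_cancel₀ (sub_ne_zero.2 hts) (by linear_combination hs0 - ht0)
  rw [hd] at ht2 ht3 ht0
  have h2 := mul_right_cancel₀ hNd ht2
  have h3 := mul_right_cancel₀ hNd ht3
  have h0 := mul_right_cancel₀ hNd ht0
  ext i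
  fin_cases i <;>
    simp [homVec, Matrix.mulVec, dotProduct, Fin.sum_univ_four, *]

/-- A matrix is determined by its values on the homogeneous vectors of the vertices of a
coordinate simplex. -/
theorem eq_of_mulVec_homVec_eq {M N : Matrix (Fin 4) (Fin 4) ℝ} {a b t d : ℝ} (hd : d ≠ 0)
    (h : M.mulVec (homVec a b t) = N.mulVec (homVec a b t))
    (ha : M.mulVec (homVec (a + d) b t) = N.mulVec (homVec (a + d) b t))
    (hb : M.mulVec (homVec a (b + d) t) = N.mulVec (homVec a (b + d) t))
    (ht : M.mulVec (homVec a b (t + d)) = N.mulVec (homVec a b (t + d))) : M = N := by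
  ext i j
  have h := congrFun h i
  have ha := congrFun ha i
  have hb := congrFun hb i
  have ht := congrFun ht i
  simp only [homVec, Matrix.mulVec, dotProduct, Fin.sum_univ_four, Matrix.cons_val, mul_one]
    at h ha hb ht
  have h0 : M i 0 = N i 0 := mul_right_cancel₀ hd (by linear_combination ht - h)
  have h2 : M i 2 = N i 2 := mul_right_cancel₀ hd (by linear_combination ha - h)
  have h3 : M i 3 = N i 3 := mul_right_cancel₀ hd (by linear_combination hb - h)
  have h1 : M i 1 = N i 1 := by
    rw [h0, h2, h3] at h
    linarith
  fin_cases j <;> assumption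

/-- The correspondence `M ↦ A_M` from `𝒢` to fractal-linear transformations is
injective: if `M, N ∈ 𝒢` agree (with nonvanishing denominators) on a nonempty open
subset `U ⊆ ℝ³`, then `M = N`. -/
theorem fracLin_injective (M N : Matrix (Fin 4) (Fin 4) ℝ)
    (hMdet : IsUnit M.det) (hNdet : IsUnit N.det)
    (hM : M 0 0 = 1 ∧ M 1 0 = 0 ∧ M 2 0 = 0 ∧ M 3 0 = 0)
    (hN : N 0 0 = 1 ∧ N 1 0 = 0 ∧ N 2 0 = 0 ∧ N 3 0 = 0)
    (U : Set (ℝ × ℝ × ℝ)) (hU : IsOpen U) (hne : U.Nonempty)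
    (h : ∀ p ∈ U, fracDen M p.1 p.2.1 p.2.2 ≠ 0 ∧ fracDen N p.1 p.2.1 p.2.2 ≠ 0 ∧
      fracLin M p.1 p.2.1 p.2.2 = fracLin N p.1 p.2.1 p.2.2) :
    M = N := by
  have key : ∀ a b t, (a, b, t) ∈ U → M.mulVec (homVec a b t) = N.mulVec (homVec a b t) := by
    intro a b t hp
    obtain ⟨ε, hε, hball⟩ := Metric.isOpen_iff.1 hU _ hp
    have hq : (a, b, t + ε / 2) ∈ U := hball (by
      simp [Prod.dist_eq, abs_of_pos hε, hε])
    obtain ⟨hMd, hNd, he⟩ := h _ hp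
    exact mulVec_homVec_eq_of_fracLin_eq hM hN (by linarith : t < t + ε / 2).ne hMd hNd he
      (h _ hq).2.2
  obtain ⟨⟨a, b, t⟩, hp⟩ := hne
  obtain ⟨ε, hε, hball⟩ := Metric.isOpen_iff.1 hU _ hp
  refine eq_of_mulVec_homVec_eq (half_pos hε).ne' (key a b t hp) (key _ _ _ (hball ?_))
    (key _ _ _ (hball ?_)) (key _ _ _ (hball ?_)) <;>
    simp [Prod.dist_eq, abs_of_pos hε, hε]
end

section
/- Let I ⊆ ℝ be an open interval, Y : I → ℝ² and T : I → ℝ twice differentiable, and suppose T'(t) ≠ 0 for all t ∈ I. Then there exist α, β ∈ ℝ² with Y(t) = T(t)·α + β for all t ∈ I if and only if T'(t)·Y''(t) − T''(t)·Y'(t) = 0 for all t ∈ I. -/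
/-- On an open interval, a function with vanishing derivative is constant. -/
theorem exists_const_of_hasDerivAt_zero {E : Type*} [NormedAddCommGroup E] [NormedSpace ℝ E]
    {I : Set ℝ} (hIopen : IsOpen I) (hIconn : I.OrdConnected) {f : ℝ → E}
    (hf : ∀ t ∈ I, HasDerivAt f 0 t) : ∃ c, ∀ t ∈ I, f t = c :=
  hIopen.exists_is_const_of_deriv_eq_zero hIconn.isPreconnected
    (fun t ht => (hf t ht).differentiableAt.differentiableWithinAt)
    (fun t ht => (hf t ht).deriv)

/-- Functions agreeing on an open set have the same derivatives there. -/
theorem hasDerivAt_unique_of_eqOn {E : Type*} [NormedAddCommGroup E] [NormedSpace ℝ E]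
    {I : Set ℝ} (hIopen : IsOpen I) {f g : ℝ → E} {f' g' : E} {t : ℝ} (ht : t ∈ I)
    (hfg : ∀ s ∈ I, f s = g s) (hf : HasDerivAt f f' t) (hg : HasDerivAt g g' t) : f' = g' :=
  hf.unique (hg.congr_of_eventuallyEq (Filter.eventuallyEq_of_mem (hIopen.mem_nhds ht) hfg))

/-- Straight lines after reparameterization: for twice differentiable `Y : I → ℝ²`
and `T : I → ℝ` on an open interval `I` with `T' ≠ 0` on `I`, the curve `Y` is an
affine function of the new parameter `T`, i.e. `Y = T·α + β` on `I` for some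
`α, β ∈ ℝ²`, if and only if `T'·Y'' − T''·Y' = 0` on `I`. -/
theorem affine_in_reparameterization_iff
    (I : Set ℝ) (hIopen : IsOpen I) (hIconn : I.OrdConnected)
    (Y Y' Y'' : ℝ → Fin 2 → ℝ) (T T' T'' : ℝ → ℝ)
    (hY : ∀ t ∈ I, HasDerivAt Y (Y' t) t)
    (hY' : ∀ t ∈ I, HasDerivAt Y' (Y'' t) t)
    (hT : ∀ t ∈ I, HasDerivAt T (T' t) t)
    (hT' : ∀ t ∈ I, HasDerivAt T' (T'' t) t)
    (hT'ne : ∀ t ∈ I, T' t ≠ 0) :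
    (∃ α β : Fin 2 → ℝ, ∀ t ∈ I, Y t = T t • α + β) ↔
      (∀ t ∈ I, T' t • Y'' t - T'' t • Y' t = 0) := by
  constructor
  · rintro ⟨α, β, h⟩ t ht
    have h1 : ∀ s ∈ I, Y' s = T' s • α := fun s hs =>
      hasDerivAt_unique_of_eqOn hIopen hs h (hY s hs) (((hT s hs).smul_const α).add_const β)
    have h2 : Y'' t = T'' t • α :=
      hasDerivAt_unique_of_eqOn hIopen ht h1 (hY' t ht) ((hT' t ht).smul_const α)
    rw [h1 t ht, h2, smul_smul, smul_smul, mul_comm, sub_self]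
  · intro h
    obtain ⟨α, hα⟩ := exists_const_of_hasDerivAt_zero hIopen hIconn
      (f := fun t => (T' t)⁻¹ • Y' t) (fun t ht => by
        have hne := hT'ne t ht
        refine (((hT' t ht).fun_inv hne).fun_smul (hY' t ht)).congr_deriv ?_
        calc (T' t)⁻¹ • Y'' t + (-T'' t / T' t ^ 2) • Y' t
            = (T' t ^ 2)⁻¹ • (T' t • Y'' t - T'' t • Y' t) := by
              ext i
              simp only [Pi.add_apply, Pi.sub_apply, Pi.smul_apply, smul_eq_mul]
              field_simp
              ring
          _ = 0 := by rw [h t ht, smul_zero])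
    have hY'α : ∀ t ∈ I, Y' t = T' t • α := fun t ht => by
      rw [← hα t ht, smul_inv_smul₀ (hT'ne t ht)]
    obtain ⟨β, hβ⟩ := exists_const_of_hasDerivAt_zero hIopen hIconn
      (f := fun t => Y t - T t • α) (fun t ht =>
        ((hY t ht).fun_sub ((hT t ht).smul_const α)).congr_deriv
          (by rw [hY'α t ht, sub_self]))
    exact ⟨α, β, fun t ht => by rw [← hβ t ht]; abel⟩
end

section
/- Define an alternating bilinear bracket [·,·] on ℝ¹² with basis X₁,…,X₁₂ (dual to the coframe ξ = (η¹,…,η⁵,θ¹,…,θ⁶,Φ)) by the rule ξᵏ([Xᵢ,Xⱼ]) = −dξᵏ(Xᵢ,Xⱼ), where the 2-forms dξᵏ are given by the structure equations (6): dη¹ = (θ⁴−θ³)∧η¹ + θ⁵∧η², dη² = θ⁴∧η² + η¹∧η⁵, dη³ = θ²∧η² + (θ⁴+θ¹−θ³)∧η³ + η¹∧η⁴, dη⁴ = θ⁶∧η³ + θ¹∧η⁴ + θ²∧η⁵, dη⁵ = θ⁶∧η² + θ³∧η⁵, dθ¹ = θ⁵∧η⁵ + θ⁶∧η¹, dθ²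 = Φ∧η³ + (θ¹−θ³)∧θ² + θ⁵∧η⁴, dθ³ = Φ∧η² + 2θ⁵∧η⁵ + θ⁶∧η¹, dθ⁴ = 2Φ∧η² + θ⁵∧η⁵ − θ⁶∧η¹, dθ⁵ = Φ∧η¹ − θ³∧θ⁵, dθ⁶ = Φ∧η⁵ + (θ³−θ⁴)∧θ⁶, dΦ = Φ∧θ⁴ + θ⁵∧θ⁶. Then this bracket satisfies the Jacobi identity, i.e. (ℝ¹², [·,·]) is a Lie algebra. -/
/-- The bracket on `ℝ¹²` determined by the structure equations (6): with coordinates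
`(η¹,…,η⁵,θ¹,…,θ⁶,Φ)` indexed `0,…,11`, the bracket is defined by
`ξᵏ([X,Y]) = −dξᵏ(X,Y)` with the convention `α∧β(X,Y) = α(X)β(Y) − α(Y)β(X)`. -/
def structureBracket (u v : Fin 12 → ℝ) : Fin 12 → ℝ :=
  -- dη¹ = (θ⁴−θ³)∧η¹ + θ⁵∧η²
  ![-(((u 8 - u 7) * v 0 - (v 8 - v 7) * u 0) + (u 9 * v 1 - v 9 * u 1)),
  -- dη² = θ⁴∧η² + η¹∧η⁵
    -((u 8 * v 1 - v 8 * u 1) + (u 0 * v 4 - v 0 * u 4)),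
  -- dη³ = θ²∧η² + (θ⁴+θ¹−θ³)∧η³ + η¹∧η⁴
    -((u 6 * v 1 - v 6 * u 1) + ((u 8 + u 5 - u 7) * v 2 - (v 8 + v 5 - v 7) * u 2)
      + (u 0 * v 3 - v 0 * u 3)),
  -- dη⁴ = θ⁶∧η³ + θ¹∧η⁴ + θ²∧η⁵
    -((u 10 * v 2 - v 10 * u 2) + (u 5 * v 3 - v 5 * u 3) + (u 6 * v 4 - v 6 * u 4)),
  -- dη⁵ = θ⁶∧η² + θ³∧η⁵
    -((u 10 * v 1 - v 10 * u 1) + (u 7 * v 4 - v 7 * u 4)),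
  -- dθ¹ = θ⁵∧η⁵ + θ⁶∧η¹
    -((u 9 * v 4 - v 9 * u 4) + (u 10 * v 0 - v 10 * u 0)),
  -- dθ² = Φ∧η³ + (θ¹−θ³)∧θ² + θ⁵∧η⁴
    -((u 11 * v 2 - v 11 * u 2) + ((u 5 - u 7) * v 6 - (v 5 - v 7) * u 6)
      + (u 9 * v 3 - v 9 * u 3)),
  -- dθ³ = Φ∧η² + 2θ⁵∧η⁵ + θ⁶∧η¹
    -((u 11 * v 1 - v 11 * u 1) + 2 * (u 9 * v 4 - v 9 * u 4) + (u 10 * v 0 - v 10 * u 0)),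
  -- dθ⁴ = 2Φ∧η² + θ⁵∧η⁵ − θ⁶∧η¹
    -(2 * (u 11 * v 1 - v 11 * u 1) + (u 9 * v 4 - v 9 * u 4) - (u 10 * v 0 - v 10 * u 0)),
  -- dθ⁵ = Φ∧η¹ − θ³∧θ⁵
    -((u 11 * v 0 - v 11 * u 0) - (u 7 * v 9 - v 7 * u 9)),
  -- dθ⁶ = Φ∧η⁵ + (θ³−θ⁴)∧θ⁶
    -((u 11 * v 4 - v 11 * u 4) + ((u 7 - u 8) * v 10 - (v 7 - v 8) * u 10)),
  -- dΦ = Φ∧θ⁴ + θ⁵∧θ⁶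
    -((u 11 * v 8 - v 11 * u 8) + (u 9 * v 10 - v 9 * u 10))]

/-- The bracket on `ℝ¹²` defined from the structure equations (6) satisfies the
Jacobi identity, i.e. `(ℝ¹², [·,·])` is a Lie algebra. -/
theorem structureBracket_jacobi (u v w : Fin 12 → ℝ) :
    structureBracket u (structureBracket v w) +
      structureBracket v (structureBracket w u) +
      structureBracket w (structureBracket u v) = 0 := by
  ext k
  fin_cases k <;> simp [structureBracket] <;> ring
end

section
/- The 12-dimensional Lie algebra determined by the structure equations (6) — namely ℝ¹² with basis X₁,…,X₁₂ dual to (η¹,…,η⁵,θ¹,…,θ⁶,Φ) and bracket defined by ξᵏ([Xᵢ,Xⱼ]) = −dξᵏ(Xᵢ,Xⱼ) using the 2-forms dη¹ = (θ⁴−θ³)∧η¹ + θ⁵∧η², dη² = θ⁴∧η² + η¹∧η⁵, dη³ = θ²∧η² + (θ⁴+θ¹−θ³)∧η³ + η¹∧η⁴, dη⁴ = θ⁶∧η³ + θ¹∧η⁴ + θ²∧η⁵, dη⁵ = θ⁶∧η² + θ³∧η⁵, dθ¹ = θ⁵∧η⁵ + θ⁶∧η¹, dθ² = Φ∧η³ +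 (θ¹−θ³)∧θ² + θ⁵∧η⁴, dθ³ = Φ∧η² + 2θ⁵∧η⁵ + θ⁶∧η¹, dθ⁴ = 2Φ∧η² + θ⁵∧η⁵ − θ⁶∧η¹, dθ⁵ = Φ∧η¹ − θ³∧θ⁵, dθ⁶ = Φ∧η⁵ + (θ³−θ⁴)∧θ⁶, dΦ = Φ∧θ⁴ + θ⁵∧θ⁶ — is isomorphic as a Lie algebra to the Lie algebra 𝔤 of 4×4 real matrices with zero first column, equipped with the commutator bracket. -/
/-- `𝔤`: the submodule of 4×4 real matrices with zero first column. -/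
def zeroFirstColumn : Submodule ℝ (Matrix (Fin 4) (Fin 4) ℝ) where
  carrier := {X | ∀ i, X i 0 = 0}
  zero_mem' := fun i => rfl
  add_mem' := by
    intro X Y hX hY i
    simp [Matrix.add_apply, hX i, hY i]
  smul_mem' := by
    intro c X hX i
    simp [Matrix.smul_apply, hX i]

/-- The matrix `[[0, ξᵀ], [0, Aᵀ]]`, where the structure equations of `ξ = (η³, η⁴, θ²)` read
`dξ = A ∧ ξ` and the remaining ones are equivalent to `dA = A ∧ A`. -/
def structureMatrix (u : Fin 12 → ℝ) : Matrix (Fin 4) (Fin 4) ℝ :=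
  !![0, u 2, u 3, u 6;
     0, u 8 + u 5 - u 7, u 10, u 11;
     0, u 0, u 5, u 9;
     0, -u 1, -u 4, u 5 - u 7]

theorem structureMatrix_structureBracket (u v : Fin 12 → ℝ) :
    structureMatrix (structureBracket u v) =
      structureMatrix u * structureMatrix v - structureMatrix v * structureMatrix u := by
  ext i j
  fin_cases i <;> fin_cases j <;>
    simp [structureMatrix, structureBracket] <;> ring

/-- `structureMatrix` as a linear equivalence onto the matrices with zero first column. -/
def structureMatrixEquiv : (Fin 12 → ℝ) ≃ₗ[ℝ] zeroFirstColumn where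
  toFun u := ⟨structureMatrix u, fun i => by fin_cases i <;> rfl⟩
  map_add' u v := by
    ext i j
    fin_cases i <;> fin_cases j <;> simp [structureMatrix] <;> ring
  map_smul' c u := by
    ext i j
    fin_cases i <;> fin_cases j <;> simp [structureMatrix] <;> ring
  invFun M :=
    ![M.1 2 1, -M.1 3 1, M.1 0 1, M.1 0 2, -M.1 3 2, M.1 2 2, M.1 0 3, M.1 2 2 - M.1 3 3,
      M.1 1 1 - M.1 3 3, M.1 2 3, M.1 1 2, M.1 1 3]
  left_inv u := by
    ext k
    fin_cases k <;> simp [structureMatrix]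
  right_inv M := by
    obtain ⟨M, hM⟩ := M
    have h (i : Fin 4) : M i 0 = 0 := hM i
    ext i j
    fin_cases i <;> fin_cases j <;> simp [structureMatrix, h] <;> ring

/-- The 12-dimensional Lie algebra determined by the structure equations (6) is
isomorphic to the Lie algebra `𝔤` of 4×4 real matrices with zero first column under
the commutator bracket: there is a linear equivalence `e : ℝ¹² ≃ₗ 𝔤` carrying the
structure bracket to the commutator `XY − YX`. -/
theorem structureLieAlgebra_iso_zeroFirstColumn :
    ∃ e : (Fin 12 → ℝ) ≃ₗ[ℝ] zeroFirstColumn,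
      ∀ u v : Fin 12 → ℝ,
        ((e (structureBracket u v) : Matrix (Fin 4) (Fin 4) ℝ)) =
          (e u : Matrix (Fin 4) (Fin 4) ℝ) * (e v : Matrix (Fin 4) (Fin 4) ℝ) -
            (e v : Matrix (Fin 4) (Fin 4) ℝ) * (e u : Matrix (Fin 4) (Fin 4) ℝ) :=
  ⟨structureMatrixEquiv, structureMatrix_structureBracket⟩
end
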